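/- arXiv:2503.03463 — 4 statements merged into one kernel-verified Lean document; each statement's English description precedes it below -/
import Mathlib

section
/- Let ρ, τ, γ ∈ ℝ with ρ ≠ 0 and τ ≠ 0. Let y, p^t, p^x : ℝ² → ℝ be continuously differentiable and suppose they satisfy the Herglotz–Hamilton–de Donder–Weyl equations for the damped-string Hamiltonian: ∂y/∂t = p^t/ρ, ∂y/∂x = −p^x/τ, and ∂p^t/∂t + ∂p^x/∂x = −γ p^t everywhere on ℝ². Then y is twice differentiable and satisfies the damped wave equation ∂²y/∂t² − (τ/ρ) ∂²y/∂x² = −γ ∂y/∂t everywhere on ℝ². -/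
/-- If `y, pᵗ, pˣ : ℝ² → ℝ` are `C¹` and satisfy the
Herglotz–Hamilton–de Donder–Weyl equations for the damped-string Hamiltonian
`H = (pᵗ)²/(2ρ) − (pˣ)²/(2τ) + γ sᵗ` (with `ρ, τ ≠ 0`), namely
`∂y/∂t = pᵗ/ρ`, `∂y/∂x = −pˣ/τ`, `∂pᵗ/∂t + ∂pˣ/∂x = −γ pᵗ`,
then `y` is twice differentiable and satisfies the damped wave equation
`y_tt − (τ/ρ) y_xx = −γ y_t`. -/
theorem stmt_3 (ρ τ γ : ℝ) (hρ : ρ ≠ 0) (hτ : τ ≠ 0)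
    (y pt px : ℝ × ℝ → ℝ)
    (hy : ContDiff ℝ 1 y) (hpt : ContDiff ℝ 1 pt) (hpx : ContDiff ℝ 1 px)
    (h1 : ∀ p : ℝ × ℝ, fderiv ℝ y p (1, 0) = pt p / ρ)
    (h2 : ∀ p : ℝ × ℝ, fderiv ℝ y p (0, 1) = -(px p / τ))
    (h3 : ∀ p : ℝ × ℝ,
      fderiv ℝ pt p (1, 0) + fderiv ℝ px p (0, 1) = -(γ * pt p)) :
    (∀ p : ℝ × ℝ, DifferentiableAt ℝ (fderiv ℝ y) p) ∧
      (∀ p : ℝ × ℝ,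
        fderiv ℝ (fun q => fderiv ℝ y q (1, 0)) p (1, 0) -
            (τ / ρ) * fderiv ℝ (fun q => fderiv ℝ y q (0, 1)) p (0, 1) =
          -γ * fderiv ℝ y p (1, 0)) := by
  have dpt : Differentiable ℝ pt := hpt.differentiable (by norm_num)
  have dpx : Differentiable ℝ px := hpx.differentiable (by norm_num)
  have key : fderiv ℝ y = fun q => (pt q / ρ) • ContinuousLinearMap.fst ℝ ℝ ℝ +
      (-(px q / τ)) • ContinuousLinearMap.snd ℝ ℝ ℝ := by
    funext q
    ext
    · simp [h1]
    · simp [h2]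
  refine ⟨fun p => ?_, fun p => ?_⟩
  · rw [key]
    have a : Differentiable ℝ (fun q => pt q / ρ) := by
      simpa [div_eq_inv_mul] using dpt.const_mul ρ⁻¹
    have b : Differentiable ℝ (fun q => -(px q / τ)) := by
      simpa [div_eq_inv_mul] using dpx.const_mul (-τ⁻¹)
    exact ((a.smul_const _).add (b.smul_const _)) p
  · have e1 : HasFDerivAt (fun q => fderiv ℝ y q (1, 0)) (ρ⁻¹ • fderiv ℝ pt p) p := by
      have := (dpt p).hasFDerivAt.const_smul ρ⁻¹
      refine this.congr_of_eventuallyEq (Filter.Eventually.of_forall fun q => ?_)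
      simp [h1, div_eq_inv_mul]
    have e2 : HasFDerivAt (fun q => fderiv ℝ y q (0, 1)) ((-τ⁻¹) • fderiv ℝ px p) p := by
      have := (dpx p).hasFDerivAt.const_smul (-τ⁻¹)
      refine this.congr_of_eventuallyEq (Filter.Eventually.of_forall fun q => ?_)
      simp [h2, div_eq_inv_mul]
    rw [e1.fderiv, e2.fderiv, h1]
    have h := h3 p
    simp only [smul_apply, smul_eq_mul]
    field_simp
    linarith
end

section
/- Let V be a real vector space of finite dimension N + m with N ≥ m ≥ 1, let K ⊆ V be a linear subspace with dim K = N, let Θ be an alternating m-form on V, let Ω be an alternating (m+1)-form on V, and let 𝔯 ⊆ V be a linear subspace such that {ι_R Θ : R ∈ 𝔯} = A^{m−1}(K). Then there exists at most one linear functional σ ∈ V* such that σ ∧ ι_R Θ = ι_R Ω for every R ∈ 𝔯. (This is the pointwise linear-algebra version of the uniqueness of the dissipation form of a (pre)multicontact manifold, with Ω playing the role of dΘ.) -/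
/-- A subspace of codimension at least `k` is annihilated by some nonzero `k`-form. -/
theorem exists_form (k : ℕ) (V : Type*) [AddCommGroup V] [Module ℝ V] [FiniteDimensional ℝ V]
    (L : Submodule ℝ V) (hL : k ≤ Module.finrank ℝ (V ⧸ L)) :
    ∃ (β : AlternatingMap ℝ V ℝ (Fin k)) (w : Fin k → V), β w = 1 ∧
      ∀ v ∈ L, ∀ u : Fin k → V, (∃ i, u i = v) → β u = 0 := by
  obtain ⟨f, hf⟩ := exists_linearIndependent_of_le_finrank hL
  obtain ⟨g, hg⟩ := LinearMap.exists_leftInverse_of_injective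
    (Fintype.linearCombination ℝ f) (LinearMap.ker_eq_bot.2 hf.fintypeLinearCombination_injective)
  choose w hw using fun i => L.mkQ_surjective (f i)
  refine ⟨(Pi.basisFun ℝ (Fin k)).det.compLinearMap (g ∘ₗ L.mkQ), w, ?_, ?_⟩
  · have h : (fun i => (g ∘ₗ L.mkQ) (w i)) = Pi.basisFun ℝ (Fin k) := by
      funext i
      have := LinearMap.congr_fun hg (Pi.single i 1)
      simp only [LinearMap.comp_apply, Fintype.linearCombination_apply_single, one_smul,
        LinearMap.id_apply] at this
      rw [LinearMap.comp_apply, hw, this, Pi.basisFun_apply]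
    rw [AlternatingMap.compLinearMap_apply]
    exact (congrArg _ h).trans (Module.Basis.det_self _)
  · rintro v hv u ⟨i, rfl⟩
    rw [AlternatingMap.compLinearMap_apply]
    apply AlternatingMap.map_coord_zero _ i
    have : L.mkQ (u i) = 0 := by simpa using hv
    simp only [LinearMap.comp_apply, this, map_zero]

/-- Pointwise uniqueness of the dissipation form.  Here `m = k + 1 ≥ 1`,
`V` has dimension `N + m` with `N ≥ m`, `K ⊆ V` is a subspace with `dim K = N`
(playing the role of `ker ω`), `Θ` is an alternating `m`-form, `Ω` an alternating
`(m+1)`-form (playing the role of `dΘ`), and `𝔯 ⊆ V` is a subspace such that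
`{ι_R Θ : R ∈ 𝔯} = A^{m−1}(K)`, where `A^{m−1}(K)` is the set of `(m−1)`-forms
annihilated by contraction with every vector of `K`.  Then there is at most one
linear functional `σ ∈ V*` with `σ ∧ ι_R Θ = ι_R Ω` for every `R ∈ 𝔯`; the wedge
`σ ∧ β` of a `1`-form with a `k`-form is given by
`(σ ∧ β)(v₀,…,v_k) = Σᵢ (−1)ⁱ σ(vᵢ) β(v₀,…,v̂ᵢ,…,v_k)`. -/
theorem stmt_7 (N k : ℕ) (hNm : k + 1 ≤ N)
    (V : Type*) [AddCommGroup V] [Module ℝ V] [FiniteDimensional ℝ V]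
    (hdim : Module.finrank ℝ V = N + (k + 1))
    (K : Submodule ℝ V) (hK : Module.finrank ℝ K = N)
    (Θ : AlternatingMap ℝ V ℝ (Fin (k + 1))) (Ω : AlternatingMap ℝ V ℝ (Fin (k + 2)))
    (𝔯 : Submodule ℝ V)
    (h𝔯 : ∀ β : AlternatingMap ℝ V ℝ (Fin k),
      (∃ R ∈ 𝔯, ∀ w : Fin k → V, β w = Θ (Fin.cons R w)) ↔
        (∀ v ∈ K, ∀ w : Fin k → V, (∃ i, w i = v) → β w = 0))
    (σ₁ σ₂ : V →ₗ[ℝ] ℝ)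
    (h₁ : ∀ R ∈ 𝔯, ∀ v : Fin (k + 1) → V,
      ∑ i : Fin (k + 1),
          (-1 : ℝ) ^ (i : ℕ) * σ₁ (v i) * Θ (Fin.cons R (fun j => v (i.succAbove j))) =
        Ω (Fin.cons R v))
    (h₂ : ∀ R ∈ 𝔯, ∀ v : Fin (k + 1) → V,
      ∑ i : Fin (k + 1),
          (-1 : ℝ) ^ (i : ℕ) * σ₂ (v i) * Θ (Fin.cons R (fun j => v (i.succAbove j))) =
        Ω (Fin.cons R v)) :
    σ₁ = σ₂ := by
  have key : ∀ v, σ₁ v = σ₂ v := by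
    intro v
    have hL : k ≤ Module.finrank ℝ (V ⧸ (K ⊔ Submodule.span ℝ {v})) := by
      have a := Submodule.finrank_quotient_add_finrank (K ⊔ Submodule.span ℝ {v})
      have b := Submodule.finrank_add_le_finrank_add_finrank K (Submodule.span ℝ {v})
      have c := finrank_span_le_card (R := ℝ) ({v} : Set V)
      simp only [Set.toFinset_singleton, Finset.card_singleton] at c
      omega
    obtain ⟨β, w, hw, hβ⟩ := exists_form k V _ hL
    obtain ⟨R, hR, hRβ⟩ := (h𝔯 β).2
      (fun x hx u hu => hβ x (Submodule.mem_sup_left hx) u hu)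
    have ev : ∀ σ : V →ₗ[ℝ] ℝ, ∑ i : Fin (k + 1), (-1 : ℝ) ^ (i : ℕ) *
        σ ((Fin.cons v w : Fin (k + 1) → V) i) *
        Θ (Fin.cons R (fun j => (Fin.cons v w : Fin (k + 1) → V) (i.succAbove j))) = σ v := by
      intro σ
      rw [Finset.sum_eq_single 0]
      · rw [← hRβ]
        simp [hw]
      · intro i _ hi
        obtain ⟨j, hj⟩ := Fin.exists_succAbove_eq hi.symm
        rw [← hRβ, hβ v (Submodule.mem_sup_right (Submodule.mem_span_singleton_self v)) _
          ⟨j, by rw [hj, Fin.cons_zero]⟩, mul_zero]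
      · simp
    rw [← ev σ₁, ← ev σ₂, h₁ R hR, h₂ R hR]
  exact LinearMap.ext key
end

section
/- Let V be a real vector space, m ≥ 1, let ω and Θ be alternating m-forms on V, let Ω be an alternating (m+1)-form on V, and let Φ : V → V be a linear isomorphism with Φ*ω = ω, Φ*Θ = Θ and Φ*Ω = Ω. Define K := {v ∈ V : ι_v ω = 0} and D := {v ∈ K : ι_v Ω ∈ A^m(K)}. If σ ∈ V* satisfies σ ∧ ι_R Θ = ι_R Ω for every R ∈ D, then the pullback Φ*σ := σ ∘ Φ also satisfies (Φ*σ) ∧ ι_R Θ = ι_R Ω for every R ∈ D. (This is the pointwise linear-algebra version of the statement that a strong Noether symmetry preserves the dissipation form, with Ω playing the role of dΘ.) -/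
/-- A linear isomorphism preserving `ω`, `Θ` and `Ω` preserves the
dissipation form.  Here `m = k + 1 ≥ 1`, `ω, Θ` are alternating `m`-forms, `Ω` is an
alternating `(m+1)`-form (playing the role of `dΘ`), `K = {v : ι_v ω = 0}` and
`D = {v ∈ K : ι_v Ω ∈ Aᵐ(K)}` (the Reeb space).  If `Φ : V → V` is a linear
isomorphism with `Φ*ω = ω`, `Φ*Θ = Θ`, `Φ*Ω = Ω`, and `σ ∈ V*` satisfies
`σ ∧ ι_R Θ = ι_R Ω` for every `R ∈ D`, then `Φ*σ = σ ∘ Φ` satisfies the same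
identity; the wedge of a `1`-form with a `k`-form is
`(σ ∧ β)(v₀,…,v_k) = Σᵢ (−1)ⁱ σ(vᵢ) β(v₀,…,v̂ᵢ,…,v_k)`. -/
theorem stmt_9 (k : ℕ) (V : Type*) [AddCommGroup V] [Module ℝ V]
    (ω Θ : AlternatingMap ℝ V ℝ (Fin (k + 1))) (Ω : AlternatingMap ℝ V ℝ (Fin (k + 2)))
    (Φ : V ≃ₗ[ℝ] V)
    (hω : ∀ v : Fin (k + 1) → V, ω (fun i => Φ (v i)) = ω v)
    (hΘ : ∀ v : Fin (k + 1) → V, Θ (fun i => Φ (v i)) = Θ v)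
    (hΩ : ∀ v : Fin (k + 2) → V, Ω (fun i => Φ (v i)) = Ω v)
    (K : Set V) (hK : K = {v : V | ∀ w : Fin k → V, ω (Fin.cons v w) = 0})
    (D : Set V)
    (hD : D = {v : V | v ∈ K ∧
      ∀ u ∈ K, ∀ w : Fin k → V, Ω (Fin.cons v (Fin.cons u w)) = 0})
    (σ : V →ₗ[ℝ] ℝ)
    (hσ : ∀ R ∈ D, ∀ v : Fin (k + 1) → V,
      ∑ i : Fin (k + 1),
          (-1 : ℝ) ^ (i : ℕ) * σ (v i) * Θ (Fin.cons R (fun j => v (i.succAbove j))) =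
        Ω (Fin.cons R v)) :
    ∀ R ∈ D, ∀ v : Fin (k + 1) → V,
      ∑ i : Fin (k + 1),
          (-1 : ℝ) ^ (i : ℕ) * σ (Φ (v i)) * Θ (Fin.cons R (fun j => v (i.succAbove j))) =
        Ω (Fin.cons R v) := by
  have hc : ∀ (n : ℕ) (a : V) (w : Fin n → V),
      (fun i => Φ ((Fin.cons a w : Fin (n + 1) → V) i)) =
        (Fin.cons (Φ a) (fun i => Φ (w i)) : Fin (n + 1) → V) := by
    intro n a w
    funext i
    refine Fin.cases ?_ (fun j => ?_) i <;> simp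
  have hω' : ∀ (a : V) (w : Fin k → V),
      ω (Fin.cons (Φ a) (fun i => Φ (w i))) = ω (Fin.cons a w) := by
    intro a w
    rw [← hc, hω]
  have hΘ' : ∀ (a : V) (w : Fin k → V),
      Θ (Fin.cons (Φ a) (fun i => Φ (w i))) = Θ (Fin.cons a w) := by
    intro a w
    rw [← hc, hΘ]
  have hΩ' : ∀ (a : V) (w : Fin (k + 1) → V),
      Ω (Fin.cons (Φ a) (fun i => Φ (w i))) = Ω (Fin.cons a w) := by
    intro a w
    rw [← hc, hΩ]
  have hsymm : ∀ w : Fin k → V, w = fun i => Φ (Φ.symm (w i)) := by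
    intro w
    funext i
    simp
  have hK1 : ∀ u ∈ K, Φ u ∈ K := by
    subst hK
    intro u hu w
    rw [hsymm w, hω' u (fun i => Φ.symm (w i))]
    exact hu _
  have hK2 : ∀ u ∈ K, Φ.symm u ∈ K := by
    subst hK
    intro u hu w
    rw [← hω', LinearEquiv.apply_symm_apply]
    exact hu _
  have hD1 : ∀ R ∈ D, Φ R ∈ D := by
    subst hD
    rintro R ⟨hR, h⟩
    refine ⟨hK1 R hR, fun u hu w => ?_⟩
    have h1 := h (Φ.symm u) (hK2 u hu) (fun i => Φ.symm (w i))
    rw [← hΩ', hc, LinearEquiv.apply_symm_apply, ← hsymm w] at h1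
    exact h1
  intro R hR v
  have h := hσ (Φ R) (hD1 R hR) (fun i => Φ (v i))
  rw [hΩ'] at h
  rw [← h]
  refine Finset.sum_congr rfl fun i _ => ?_
  rw [hΘ' R (fun j => v (i.succAbove j))]
end

section
/- Let V be a real vector space, m ≥ 1, let Θ be an alternating m-form on V, let Ω be an alternating (m+1)-form on V, let σ ∈ V*, let Y ∈ V, and let X_1, …, X_m ∈ V. Assume that (i) Θ(X_1,…,X_m) = 0 and (ii) the linear functional ι_{X_m} ⋯ ι_{X_1}(Ω + σ ∧ Θ) ∈ V* is identically zero. Then ι_{X_m} ⋯ ι_{X_1}( −ι_Y Ω + σ ∧ (ι_Y Θ) ) = 0. (This is the multilinear-algebraic core of Noether's theorem for multicontact Lagrangian systems: with Ω = dΘ_L, Ω + σ∧Θ = d̄Θ_L, and an infinitesimal Noether symmetry Y satisfying L_YΘ_L = 0, the m-form −ι_YΩ + σ∧ι_YΘ equals d̄(ι_YΘ_L), so ι_X d̄ξ_Y = 0 for every multivector field X = X_1∧⋯∧X_m solving the field equations, i.e., ξ_Y = ι_YΘ_L is a dissipated form.) -/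
theorem alt_snoc_aux {V : Type*} [AddCommGroup V] [Module ℝ V] (n : ℕ)
    (f : AlternatingMap ℝ V ℝ (Fin (n + 1))) (X : Fin n → V) (u : V) :
    f (Fin.snoc X u : Fin (n + 1) → V) = (-1 : ℝ) ^ n * f (Fin.cons u X) := by
  have h : (Fin.snoc X u : Fin (n + 1) → V) =
      (Fin.cons u X : Fin (n + 1) → V) ∘ (finRotate (n + 1)) := by
    rw [Fin.snoc_eq_cons_rotate]
    rfl
  rw [h, AlternatingMap.map_perm, sign_finRotate]
  simp [Units.smul_def]

/-- Multilinear-algebraic core of Noether's theorem for multicontact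
Lagrangian systems.  Here `m = k + 1 ≥ 1`, `Θ` is an alternating `m`-form, `Ω` an
alternating `(m+1)`-form (playing the role of `dΘ_L`), `σ ∈ V*`, `Y ∈ V` and
`X₁, …, X_m ∈ V`.  If (i) `Θ(X₁,…,X_m) = 0` and (ii) the functional
`ι_{X_m}⋯ι_{X₁}(Ω + σ∧Θ) ∈ V*` vanishes identically, then
`ι_{X_m}⋯ι_{X₁}(−ι_Y Ω + σ ∧ (ι_Y Θ)) = 0`; the wedge of a `1`-form with a `j`-form
is `(σ ∧ β)(v₀,…,v_j) = Σᵢ (−1)ⁱ σ(vᵢ) β(v₀,…,v̂ᵢ,…,v_j)`. -/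
theorem stmt_10 (k : ℕ) (V : Type*) [AddCommGroup V] [Module ℝ V]
    (Θ : AlternatingMap ℝ V ℝ (Fin (k + 1))) (Ω : AlternatingMap ℝ V ℝ (Fin (k + 2)))
    (σ : V →ₗ[ℝ] ℝ) (Y : V) (X : Fin (k + 1) → V)
    (h1 : Θ X = 0)
    (h2 : ∀ u : V,
      Ω (Fin.snoc X u : Fin (k + 2) → V) +
          ∑ i : Fin (k + 2),
            (-1 : ℝ) ^ (i : ℕ) * σ ((Fin.snoc X u : Fin (k + 2) → V) i) *
              Θ (fun j => (Fin.snoc X u : Fin (k + 2) → V) (i.succAbove j)) = 0) :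
    -Ω (Fin.cons Y X) +
        ∑ i : Fin (k + 1),
          (-1 : ℝ) ^ (i : ℕ) * σ (X i) *
            Θ (Fin.cons Y (fun j => X (i.succAbove j))) = 0 := by
  have h := h2 Y
  rw [Fin.sum_univ_castSucc, alt_snoc_aux] at h
  have hl : (fun j => (Fin.snoc X Y : Fin (k + 2) → V) ((Fin.last (k + 1)).succAbove j)) = X := by
    funext j
    simp
  have hc : ∀ i : Fin (k + 1),
      (fun j => (Fin.snoc X Y : Fin (k + 2) → V) (i.castSucc.succAbove j)) =
        (Fin.snoc (fun j => X (i.succAbove j)) Y : Fin (k + 1) → V) := by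
    intro i
    funext j
    refine Fin.lastCases ?_ (fun j => ?_) j
    · rw [Fin.succAbove_of_le_castSucc _ _ (Fin.castSucc_le_castSucc_iff.mpr (Fin.le_last i)), Fin.succ_last,
        Fin.snoc_last, Fin.snoc_last]
    · rw [Fin.castSucc_succAbove_castSucc, Fin.snoc_castSucc, Fin.snoc_castSucc]
  rw [hl, h1] at h
  simp only [hc, alt_snoc_aux, Fin.snoc_castSucc, Fin.val_castSucc] at h
  have hk : (-1 : ℝ) ^ k ≠ 0 := pow_ne_zero _ (by norm_num)
  apply (mul_eq_zero.mp _).resolve_left hk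
  rw [← h, mul_add, Finset.mul_sum, mul_zero, add_zero, pow_succ]
  congr 1
  · ring
  · exact Finset.sum_congr rfl fun i _ => by ring
end
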